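/- Let G be a graph with at least d + 1 vertices that is universally rigid in ℝ^d, i.e., every framework of G in general position in ℝ^d is universally rigid. Then every framework G(p) with p in general position in ℝ^d is infinitesimally rigid. -/

import Mathlib

open scoped BigOperators RealInnerProductSpace

noncomputable section

/-- A configuration of a framework: an assignment of points in `ℝ^d` to vertices. -/
abbrev Config (V : Type*) (d : ℕ) := V → EuclideanSpace ℝ (Fin d)

/-- A configuration is in general position if every `d + 1` of its points are
affinely independent. -/
def InGeneralPosition {V : Type*} (d : ℕ) (p : Config V d) : Prop :=
  ∀ S : Finset V, S.card = d + 1 → AffineIndependent ℝ (fun i : S => p i.1)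

/-- A framework `G(p)` in `ℝ^d` is universally rigid if for every `d' ≥ d`, every
configuration in `ℝ^{d'}` equivalent to `p` is congruent to `p`. -/
def UniversallyRigid {V : Type*} {d : ℕ} (G : SimpleGraph V) (p : Config V d) : Prop :=
  ∀ d' : ℕ, d ≤ d' → ∀ q : Config V d',
    (∀ i j, G.Adj i j → dist (p i) (p j) = dist (q i) (q j)) →
    ∀ i j, dist (p i) (p j) = dist (q i) (q j)

/-- The space of infinitesimal flexes of the framework `G(p)`. -/
def flexSpace {V : Type*} {d : ℕ} (G : SimpleGraph V) (p : Config V d) :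
    Submodule ℝ (V → EuclideanSpace ℝ (Fin d)) where
  carrier := {q | ∀ i j, G.Adj i j → ⟪p i - p j, q i - q j⟫ = (0 : ℝ)}
  zero_mem' := by intro i j _; simp
  add_mem' := by
    intro a b ha hb i j hij
    have h : (a + b) i - (a + b) j = (a i - a j) + (b i - b j) := by
      simp only [Pi.add_apply]; abel
    rw [h, inner_add_right, ha i j hij, hb i j hij, add_zero]
  smul_mem' := by
    intro c a ha i j hij
    have h : (c • a) i - (c • a) j = c • (a i - a j) := by
      simp only [Pi.smul_apply, smul_sub]
    rw [h, real_inner_smul_right, ha i j hij, mul_zero]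

/-- A framework whose points affinely span `ℝ^d` is infinitesimally rigid if its space
of infinitesimal flexes has dimension exactly `d (d + 1) / 2`. -/
def InfinitesimallyRigid {V : Type*} {d : ℕ} (G : SimpleGraph V) (p : Config V d) :
    Prop :=
  affineSpan ℝ (Set.range p) = ⊤ ∧
    Module.finrank ℝ (flexSpace G p) = d * (d + 1) / 2

/-- Skew-symmetric matrix with prescribed strictly lower triangular entries. -/
def skewMat {d : ℕ} (f : (Σ i : Fin d, Fin i.val) → ℝ) (i j : Fin d) : ℝ :=
  if h : j < i then f ⟨i, ⟨j.val, h⟩⟩ else if h : i < j then - f ⟨j, ⟨i.val, h⟩⟩ else 0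

lemma skewMat_skew {d : ℕ} (f : (Σ i : Fin d, Fin i.val) → ℝ) (i j : Fin d) :
    skewMat f i j = - skewMat f j i := by
  unfold skewMat
  rcases lt_trichotomy i j with h | h | h
  · simp [h, h.not_gt]
  · subst h; simp
  · simp [h, h.not_gt]

/-- The trivial infinitesimal motion with rotation part `f` and translation part `t`. -/
def trivialFlex {V : Type*} {d : ℕ} (p : Config V d) :
    ((Fin d → ℝ) × ((Σ i : Fin d, Fin i.val) → ℝ)) →ₗ[ℝ] (V → EuclideanSpace ℝ (Fin d)) where
  toFun x := fun v => WithLp.toLp 2 (fun i => x.1 i + ∑ j, skewMat x.2 i j * p v j)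
  map_add' x y := by
    ext v i
    have : ∀ j, skewMat (x.2 + y.2) i j = skewMat x.2 i j + skewMat y.2 i j := by
      intro j; unfold skewMat; split_ifs <;> simp; ring
    simp [this, add_mul, Finset.sum_add_distrib]; ring
  map_smul' c x := by
    ext v i
    have : ∀ j, skewMat (c • x.2) i j = c * skewMat x.2 i j := by
      intro j; unfold skewMat; split_ifs <;> simp
    simp [this, mul_assoc, mul_add, Finset.mul_sum]

lemma skew_quad {d : ℕ} (f : (Σ i : Fin d, Fin i.val) → ℝ) (x : Fin d → ℝ) :
    ∑ i, (∑ j, skewMat f i j * x j) * x i = 0 := by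
  have h : ∑ i, (∑ j, skewMat f i j * x j) * x i
      = - ∑ i, (∑ j, skewMat f i j * x j) * x i := by
    conv_lhs => simp only [Finset.sum_mul]
    rw [Finset.sum_comm]
    simp only [Finset.sum_mul, ← Finset.sum_neg_distrib]
    refine Finset.sum_congr rfl fun i _ => Finset.sum_congr rfl fun j _ => ?_
    rw [skewMat_skew f j i]; ring
  linarith

lemma trivialFlex_mem {V : Type*} {d : ℕ} (p : Config V d) (x) (i j : V) :
    ⟪p i - p j, trivialFlex p x i - trivialFlex p x j⟫ = (0 : ℝ) := by
  have := skew_quad x.2 (fun k => p i k - p j k)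
  rw [← this]
  simp only [PiLp.inner_apply, trivialFlex, LinearMap.coe_mk, AddHom.coe_mk, PiLp.sub_apply]
  refine Finset.sum_congr rfl fun k _ => ?_
  simp [mul_sub, Finset.sum_sub_distrib]

lemma exists_basis_of_general {d : ℕ} {V : Type*} (p : Config V d) (S : Finset V)
    (hS : S.card = d + 1) (hind : AffineIndependent ℝ (fun i : S => p i.1)) :
    ∃ (o : S) (b : Module.Basis {x : S // x ≠ o} ℝ (EuclideanSpace ℝ (Fin d))),
      ∀ k, b k = p k.1.1 - p o := by
  classical
  obtain ⟨o, ho⟩ : S.Nonempty := Finset.card_pos.mp (by omega)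
  have hli := (affineIndependent_iff_linearIndependent_vsub ℝ _ (⟨o, ho⟩ : S)).1 hind
  have hc : Fintype.card {x : S // x ≠ ⟨o, ho⟩}
      = Module.finrank ℝ (EuclideanSpace ℝ (Fin d)) := by
    rw [Fintype.card_subtype_compl]
    simp [hS]
  exact ⟨⟨o, ho⟩, Module.Basis.mk hli (hli.span_eq_top_of_card_eq_finrank' hc).ge,
    fun k => by simp⟩

lemma trivialFlex_injective {d : ℕ} {V : Type*} (p : Config V d) (S : Finset V)
    (hS : S.card = d + 1) (hind : AffineIndependent ℝ (fun i : S => p i.1)) :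
    Function.Injective (trivialFlex p) := by
  obtain ⟨o, b, hb⟩ := exists_basis_of_general p S hS hind
  rw [injective_iff_map_eq_zero]
  rintro ⟨t, f⟩ h
  have hv : ∀ v i, t i + ∑ j, skewMat f i j * p v j = 0 := by
    intro v i
    have := congrArg (fun z : EuclideanSpace ℝ (Fin d) => z i) (congrFun h v)
    simpa [trivialFlex] using this
  have hm : ∀ i j, skewMat f i j = 0 := by
    intro i j
    have : (WithLp.toLp 2 (fun j => skewMat f i j) : EuclideanSpace ℝ (Fin d)) = 0 := by
      refine InnerProductSpace.ext_inner_left_basis b fun k => ?_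
      rw [hb, inner_zero_right]
      have h1 := hv k.1.1 i
      have h2 := hv o i
      simp only [PiLp.inner_apply, PiLp.sub_apply, RCLike.inner_apply, conj_trivial, mul_sub,
        Finset.sum_sub_distrib]
      linarith
    simpa using congrArg (fun z : EuclideanSpace ℝ (Fin d) => z j) this
  have ht : t = 0 := by
    ext i
    have := hv o i
    simpa [hm] using this
  have hf : f = 0 := by
    ext ⟨i, j, hj⟩
    have := hm i ⟨j, hj.trans i.2⟩
    have hlt : (⟨j, hj.trans i.2⟩ : Fin d) < i := hj
    simpa [skewMat, hlt] using this
  rw [ht, hf]; rfl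

lemma exists_linear_skew {d : ℕ} {V : Type*} (p q : Config V d) (S : Finset V)
    (hS : S.card = d + 1) (hind : AffineIndependent ℝ (fun i : S => p i.1))
    (hq : ∀ i j, ⟪p i - p j, q i - q j⟫ = (0 : ℝ)) :
    ∃ (A : EuclideanSpace ℝ (Fin d) →ₗ[ℝ] EuclideanSpace ℝ (Fin d))
      (t : EuclideanSpace ℝ (Fin d)),
      (∀ x y, ⟪x, A y⟫ + ⟪y, A x⟫ = (0 : ℝ)) ∧ ∀ v, q v = t + A (p v) := by
  obtain ⟨o, b, hb⟩ := exists_basis_of_general p S hS hind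
  let A := b.constr ℝ (fun k => q k.1.1 - q o)
  have hA : ∀ k, A (b k) = q k.1.1 - q o := by intro k; simp [A]
  have hpol : ∀ i j, ⟪p i - p o, q j - q o⟫ + ⟪p j - p o, q i - q o⟫ = (0 : ℝ) := by
    intro i j
    have h1 := hq i j
    have h2 := hq i o
    have h3 := hq j o
    rw [← sub_sub_sub_cancel_right (p i) (p j) (p o),
      ← sub_sub_sub_cancel_right (q i) (q j) (q o), inner_sub_left,
      inner_sub_right (p i - p o) (q i - q o) (q j - q o),
      inner_sub_right (p j - p o) (q i - q o) (q j - q o)] at h1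
    linarith
  have hskew : ∀ x y, ⟪x, A y⟫ + ⟪y, A x⟫ = (0 : ℝ) := by
    let B : EuclideanSpace ℝ (Fin d) →ₗ[ℝ] EuclideanSpace ℝ (Fin d) →ₗ[ℝ] ℝ :=
      LinearMap.mk₂ ℝ (fun x y => ⟪x, A y⟫ + ⟪y, A x⟫)
        (by intros; simp only [map_add, inner_add_left, inner_add_right]; ring)
        (by intros; simp only [map_smul, real_inner_smul_left, real_inner_smul_right,
              smul_eq_mul]; ring)
        (by intros; simp only [map_add, inner_add_left, inner_add_right]; ring)
        (by intros; simp only [map_smul, real_inner_smul_left, real_inner_smul_right,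
              smul_eq_mul]; ring)
    have hB : B = 0 := by
      refine b.ext fun i => b.ext fun j => ?_
      change ⟪b i, A (b j)⟫ + ⟪b j, A (b i)⟫ = (0 : ℝ)
      rw [hA, hA, hb, hb]
      exact hpol _ _
    intro x y
    exact congrArg (fun C => C x y) hB
  refine ⟨A, q o - A (p o), hskew, fun v => ?_⟩
  suffices h : q v - q o - A (p v - p o) = 0 by
    rw [map_sub] at h
    rw [← sub_eq_zero, ← h]; abel
  refine InnerProductSpace.ext_inner_left_basis b fun k => ?_
  have h1 := hpol k.1.1 v
  have h2 := hskew (b k) (p v - p o)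
  rw [hA, hb] at h2
  rw [hb, inner_sub_right, inner_zero_right]
  linarith

lemma trivialFlex_surj {d : ℕ} {V : Type*} (p q : Config V d) (S : Finset V)
    (hS : S.card = d + 1) (hind : AffineIndependent ℝ (fun i : S => p i.1))
    (hq : ∀ i j, ⟪p i - p j, q i - q j⟫ = (0 : ℝ)) : ∃ x, trivialFlex p x = q := by
  obtain ⟨A, t, hA, hqA⟩ := exists_linear_skew p q S hS hind hq
  let e : Fin d → EuclideanSpace ℝ (Fin d) := fun j => EuclideanSpace.single j 1
  have hAe : ∀ i j, A (e j) i = - A (e i) j := by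
    intro i j
    have := hA (e i) (e j)
    simp only [e, EuclideanSpace.inner_single_left, map_one, one_mul] at this ⊢
    linarith
  let f : (Σ i : Fin d, Fin i.val) → ℝ := fun k => A (e ⟨k.2, k.2.2.trans k.1.2⟩) k.1
  have hf : ∀ i j, skewMat f i j = A (e j) i := by
    intro i j
    rcases lt_trichotomy i j with h | h | h
    · simp only [skewMat, h.not_gt, h, f, dif_pos, dif_neg, not_false_eq_true]
      rw [hAe i j]
    · subst h
      have := hAe i i
      simp only [skewMat, lt_irrefl, dif_neg, not_false_eq_true]
      linarith
    · simp only [skewMat, h, f, dif_pos]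
  refine ⟨(fun i => t i, f), ?_⟩
  ext v i
  rw [hqA v]
  have hp : p v = ∑ j, p v j • e j := by
    ext k
    simp [e, Pi.single_apply]
  conv_rhs => rw [hp]
  simp [trivialFlex, hf, mul_comm]

lemma flex_of_universal {V : Type*} [Fintype V] {d : ℕ} (G : SimpleGraph V)
    (hur : ∀ p : Config V d, InGeneralPosition d p → UniversallyRigid G p)
    (p : Config V d) (hp : InGeneralPosition d p) (q : Config V d) (hq : q ∈ flexSpace G p)
    (i j : V) : ⟪p i - p j, q i - q j⟫ = (0 : ℝ) := by
  have key : ∀ᶠ s in nhds (0 : ℝ), InGeneralPosition d (fun v => p v + s • q v) := by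
    unfold InGeneralPosition
    rw [Filter.eventually_all]
    intro S
    rw [Filter.eventually_imp_distrib_left]
    intro hS
    have ho := isOpen_setOfPred_affineIndependent (𝕜 := ℝ) (E := EuclideanSpace ℝ (Fin d)) (ι := S)
    have hc : Continuous (fun (s : ℝ) (v : S) => p v.1 + s • q v.1) := by fun_prop
    refine (ho.preimage hc).mem_nhds ?_
    simpa using hp S hS
  obtain ⟨s, hs, hs0⟩ : ∃ s : ℝ, InGeneralPosition d (fun v => p v + s • q v) ∧ 0 < s := by
    have h1 := (key.filter_mono (nhdsWithin_le_nhds (s := Set.Ioi 0)))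
    exact (h1.and self_mem_nhdsWithin).exists
  have exp : ∀ a b : EuclideanSpace ℝ (Fin d),
      dist a b ^ 2 = ⟪a - b, a - b⟫ := by
    intro a b
    rw [dist_eq_norm, real_inner_self_eq_norm_sq]
  have diff : ∀ v w, dist (p v + s • q v) (p w + s • q w) ^ 2
      - dist (p v - s • q v) (p w - s • q w) ^ 2 = 4 * s * ⟪p v - p w, q v - q w⟫ := by
    intro v w
    rw [exp, exp]
    have e1 : p v + s • q v - (p w + s • q w) = (p v - p w) + s • (q v - q w) := by
      rw [smul_sub]; abel
    have e2 : p v - s • q v - (p w - s • q w) = (p v - p w) - s • (q v - q w) := by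
      rw [smul_sub]; abel
    rw [e1, e2, real_inner_add_add_self, real_inner_sub_sub_self (p v - p w) (s • (q v - q w)), real_inner_smul_right]
    ring
  have := hur _ hs d le_rfl (fun v => p v - s • q v) (by
    intro v w hvw
    have h := diff v w
    rw [hq v w hvw, mul_zero, sub_eq_zero] at h
    exact (sq_eq_sq₀ dist_nonneg dist_nonneg).1 h) i j
  have h := diff i j
  rw [this, sub_self] at h
  have h4 : 4 * s ≠ 0 := by positivity
  exact (mul_eq_zero.1 h.symm).resolve_left h4

/-- If `G` has at least `d + 1` vertices and is universally rigid in `ℝ^d` (every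
framework of `G` in general position in `ℝ^d` is universally rigid), then every
framework `G(p)` with `p` in general position in `ℝ^d` is infinitesimally rigid. -/
theorem universallyRigidGraph_infinitesimallyRigid
    {V : Type*} [Fintype V] [DecidableEq V] {d : ℕ}
    (G : SimpleGraph V) (hcard : d + 1 ≤ Fintype.card V)
    (hur : ∀ p : Config V d, InGeneralPosition d p → UniversallyRigid G p) :
    ∀ p : Config V d, InGeneralPosition d p → InfinitesimallyRigid G p := by
  intro p hp
  obtain ⟨S, -, hS⟩ := Finset.exists_subset_card_eq (s := (Finset.univ : Finset V)) hcard
  have hind := hp S hS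
  constructor
  · have h := hind.affineSpan_eq_top_iff_card_eq_finrank_add_one.2 (by simp [hS])
    refine top_le_iff.1 (h.ge.trans (affineSpan_mono ℝ ?_))
    rintro _ ⟨v, rfl⟩
    exact ⟨v.1, rfl⟩
  · have hr : flexSpace G p = LinearMap.range (trivialFlex p) := by
      ext q
      constructor
      · intro hq
        exact trivialFlex_surj p q S hS hind (flex_of_universal G hur p hp q hq)
      · rintro ⟨x, rfl⟩ i j _
        exact trivialFlex_mem p x i j
    rw [hr, LinearMap.finrank_range_of_inj (trivialFlex_injective p S hS hind)]
    simp only [Module.finrank_prod, Module.finrank_pi, Fintype.card_fin, Fintype.card_sigma]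
    rw [Fin.sum_univ_eq_sum_range (fun i => i) d]
    have h2 := Finset.sum_range_id_mul_two (d + 1)
    rw [Finset.sum_range_succ] at h2
    simp only [Nat.add_sub_cancel] at h2
    rw [mul_comm (d + 1) d] at h2
    omega
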